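/- arXiv:1103.4441 — 2 statements merged into one kernel-verified Lean document; each statement's English description precedes it below -/
import Mathlib

section
/- The braid relation holds for the action on ℤ⁶: for every v ∈ ℤ⁶, ((v·σ₁)·σ₂)·σ₁ = ((v·σ₂)·σ₁)·σ₂, where σ₁ applies σ to the first four coordinates (fixing the last two) and σ₂ applies σ to the last four coordinates (fixing the first two). -/
/-- For `x : ℤ`, `x⁺ = max x 0`. -/
def pPart (x : ℤ) : ℤ := max x 0

/-- For `x : ℤ`, `x⁻ = min x 0`. -/
def nPart (x : ℤ) : ℤ := min x 0

/-- The map `σ : ℤ⁴ → ℤ⁴`. -/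
def sigmaMap : ℤ × ℤ × ℤ × ℤ → ℤ × ℤ × ℤ × ℤ :=
  fun (a, b, c, d) =>
    let e := a - nPart b - c + pPart d
    (a + pPart b + pPart (pPart d - e), d - pPart e,
      c + nPart d + nPart (nPart b + e), b + pPart e)

/-- The map `ρ : ℤ⁴ → ℤ⁴`, `(a,b,c,d) ↦ (c,d,a,b)`. -/
def rhoMap : ℤ × ℤ × ℤ × ℤ → ℤ × ℤ × ℤ × ℤ :=
  fun (a, b, c, d) => (c, d, a, b)

/-- `σ₁` acting on `ℤ⁶`: apply `σ` to the first four coordinates. -/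
def sigma1 : ℤ × ℤ × ℤ × ℤ × ℤ × ℤ → ℤ × ℤ × ℤ × ℤ × ℤ × ℤ :=
  fun (a₁, b₁, a₂, b₂, a₃, b₃) =>
    match sigmaMap (a₁, b₁, a₂, b₂) with
    | (x, y, z, w) => (x, y, z, w, a₃, b₃)

/-- `σ₂` acting on `ℤ⁶`: apply `σ` to the last four coordinates. -/
def sigma2 : ℤ × ℤ × ℤ × ℤ × ℤ × ℤ → ℤ × ℤ × ℤ × ℤ × ℤ × ℤ :=
  fun (a₁, b₁, a₂, b₂, a₃, b₃) =>
    match sigmaMap (a₂, b₂, a₃, b₃) with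
    | (x, y, z, w) => (a₁, b₁, x, y, z, w)

/-- `ρ₁` acting on `ℤ⁶`: exchange the first and second pairs of coordinates. -/
def rho1 : ℤ × ℤ × ℤ × ℤ × ℤ × ℤ → ℤ × ℤ × ℤ × ℤ × ℤ × ℤ :=
  fun (a₁, b₁, a₂, b₂, a₃, b₃) => (a₂, b₂, a₁, b₁, a₃, b₃)

/-- `ρ₂` acting on `ℤ⁶`: exchange the second and third pairs of coordinates. -/
def rho2 : ℤ × ℤ × ℤ × ℤ × ℤ × ℤ → ℤ × ℤ × ℤ × ℤ × ℤ × ℤ :=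
  fun (a₁, b₁, a₂, b₂, a₃, b₃) => (a₁, b₁, a₃, b₃, a₂, b₂)

/-! ### Subtraction-free rational version

The map `sigmaMap` is the tropicalization of a subtraction-free rational map.  We check the braid
relation for this rational map over an arbitrary semifield in which sums of nonzero elements are
nonzero, and then specialize to the tropical semifield. -/

section Rational

variable {K : Type*} [Semifield K]

/-- Graph of the rational lift of `sigmaMap`. -/
def GRel (A B C D X Y Z W : K) : Prop :=
  X = A * (1 + B) + B * C ∧ Y = D * B * C / (B * C + A * (1 + B) * (1 + D)) ∧
    Z = A * C * D / (C + A * (1 + D)) ∧ W = (B * C + A * (1 + B) * (1 + D)) / C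

lemma rational_braid (hK : ∀ a b : K, a ≠ 0 → a + b ≠ 0) (A B C D P Q : K)
    (hA : A ≠ 0) (hB : B ≠ 0) (hC : C ≠ 0) (hD : D ≠ 0) (hP : P ≠ 0) (hQ : Q ≠ 0)
    {A1 B1 C1 D1 C2 D2 P2 Q2 A3 B3 C3 D3 C4 D4 P4 Q4 A5 B5 C5 D5 C6 D6 P6 Q6 : K}
    (h1 : GRel A B C D A1 B1 C1 D1) (h2 : GRel C1 D1 P Q C2 D2 P2 Q2)
    (h3 : GRel A1 B1 C2 D2 A3 B3 C3 D3) (h4 : GRel C D P Q C4 D4 P4 Q4)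
    (h5 : GRel A B C4 D4 A5 B5 C5 D5) (h6 : GRel C5 D5 P4 Q4 C6 D6 P6 Q6) :
    A3 = A5 ∧ B3 = B5 ∧ C3 = C6 ∧ D3 = D6 ∧ P2 = P6 ∧ Q2 = Q6 := by
  have one : (1 : K) ≠ 0 := one_ne_zero
  obtain ⟨U, hU⟩ : ∃ U, U = C + A * (1 + D) := ⟨_, rfl⟩
  obtain ⟨W, hW⟩ : ∃ W, W = B * C + A * (1 + B) * (1 + D) := ⟨_, rfl⟩
  obtain ⟨X, hX⟩ : ∃ X, X = A * (1 + B) + B * C := ⟨_, rfl⟩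
  obtain ⟨Y, hY⟩ : ∃ Y, Y = W * P + A * C * D * (1 + B) := ⟨_, rfl⟩
  obtain ⟨Z, hZ⟩ : ∃ Z, Z = W * P + A * C * D * (1 + B) * (1 + Q) := ⟨_, rfl⟩
  obtain ⟨V, hV⟩ : ∃ V, V = U * P + A * C * D * (1 + Q) := ⟨_, rfl⟩
  obtain ⟨T, hT⟩ : ∃ T, T = P + C * (1 + Q) := ⟨_, rfl⟩
  obtain ⟨F, hF⟩ : ∃ F, F = C * (1 + D) + D * P := ⟨_, rfl⟩
  obtain ⟨G, hG⟩ : ∃ G, G = D * P + C * (1 + D) * (1 + Q) := ⟨_, rfl⟩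
  obtain ⟨S, hS⟩ : ∃ S, S = B * G + A * (1 + B) * (1 + Q) := ⟨_, rfl⟩
  obtain ⟨H, hH⟩ : ∃ H, H = G + A * (1 + Q) := ⟨_, rfl⟩
  have nU : U ≠ 0 := hU ▸ hK _ _ hC
  have nW : W ≠ 0 := hW ▸ hK _ _ (mul_ne_zero hB hC)
  have nB : 1 + B ≠ 0 := hK _ _ one
  have nD : 1 + D ≠ 0 := hK _ _ one
  have nQ : 1 + Q ≠ 0 := hK _ _ one
  have nX : X ≠ 0 := hX ▸ hK _ _ (mul_ne_zero hA nB)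
  have nY : Y ≠ 0 := hY ▸ hK _ _ (mul_ne_zero nW hP)
  have nZ : Z ≠ 0 := hZ ▸ hK _ _ (mul_ne_zero nW hP)
  have nV : V ≠ 0 := hV ▸ hK _ _ (mul_ne_zero nU hP)
  have nT : T ≠ 0 := hT ▸ hK _ _ hP
  have nF : F ≠ 0 := hF ▸ hK _ _ (mul_ne_zero hC nD)
  have nG : G ≠ 0 := hG ▸ hK _ _ (mul_ne_zero hD hP)
  have nS : S ≠ 0 := hS ▸ hK _ _ (mul_ne_zero hB nG)
  have nH : H ≠ 0 := hH ▸ hK _ _ nG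
  -- the polynomial identities behind the cancellations
  have i1 : C + W = (1 + B) * U := by rw [hW, hU]; ring
  have i2 : W + B * C * D = X * (1 + D) := by rw [hW, hX]; ring
  have i3 : Z + Q * W * P = (1 + Q) * Y := by rw [hZ, hY]; ring
  have i4 : X * X * (1 + D) + B * D * Y = W * (A * (1 + B) + B * F) := by
    rw [hY, hX, hF, hW]; ring
  have i5 : B * D * Z + X * X * (1 + D) * (1 + Q) = W * S := by
    rw [hZ, hS, hG, hX, hW]; ring
  have i6 : Z + C * X * (1 + Q) = W * T := by rw [hZ, hT, hX, hW]; ring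
  have i7 : G + Q * D * P = (1 + Q) * F := by rw [hG, hF]; ring
  have i8 : G + S = (1 + B) * H := by rw [hS, hH]; ring
  have i9 : A * D * (1 + B) * T + S * C = X * G := by rw [hS, hT, hX, hG]; ring
  have i10 : P + G = (1 + D) * T := by rw [hG, hT]; ring
  have i11 : S * C * P + A * D * (1 + B) * (1 + D) * T * T = Z * G := by
    rw [hZ, hS, hG, hT, hW]; ring
  have i12 : C * P * H + A * D * (1 + D) * T * T = V * G := by
    rw [hV, hH, hG, hT, hU]; ring
  -- step 1
  obtain ⟨a1, b1, c1, d1⟩ := h1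
  rw [← hX] at a1
  rw [← hW] at b1 d1
  rw [← hU] at c1
  -- step 2
  have e2 : 1 + D1 = (1 + B) * U / C := by rw [d1, ← i1]; field_simp
  have w2 : D1 * P + C1 * (1 + D1) * (1 + Q) = Z / C := by
    rw [e2, d1, c1, hZ]; field_simp
  have u2 : P + C1 * (1 + Q) = V / U := by rw [c1, hV]; field_simp
  obtain ⟨c2, d2, p2, q2⟩ := h2
  rw [w2] at d2 q2
  rw [u2] at p2
  have c2' : C2 = Y / C := by rw [c2, e2, d1, c1, hY]; field_simp; ring
  have d2' : D2 = Q * W * P / Z := by rw [d2, d1]; field_simp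
  have p2' : P2 = A * C * D * P * Q / V := by rw [p2, c1]; field_simp
  have q2' : Q2 = Z / (C * P) := by rw [q2]; field_simp
  -- step 3
  have e3 : 1 + B1 = X * (1 + D) / W := by rw [b1, ← i2]; field_simp
  have f3 : 1 + D2 = (1 + Q) * Y / Z := by rw [d2', ← i3]; field_simp
  have w3 : B1 * C2 + A1 * (1 + B1) * (1 + D2) = Y * S / Z := by
    have : Y * S / Z = Y * (W * S) / (W * Z) := by field_simp
    rw [this, ← i5, e3, f3, a1, b1, c2']; field_simp
  have u3 : C2 + A1 * (1 + D2) = Y * W * T / (C * Z) := by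
    have : Y * W * T / (C * Z) = Y * (W * T) / (C * Z) := by field_simp
    rw [this, ← i6, f3, a1, c2']; field_simp
  obtain ⟨a3, b3, c3, d3⟩ := h3
  rw [w3] at b3 d3
  rw [u3] at c3
  have a3' : A3 = A * (1 + B) + B * F := by
    have : A * (1 + B) + B * F = W * (A * (1 + B) + B * F) / W := by field_simp
    rw [this, ← i4, a3, e3, a1, b1, c2']; field_simp
  have b3' : B3 = Q * P * B * D / S := by rw [b3, d2', b1, c2']; field_simp
  have c3' : C3 = X * Q * P / T := by rw [c3, a1, c2', d2']; field_simp
  have d3' : D3 = C * S / Z := by rw [d3, c2']; field_simp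
  -- step 4
  obtain ⟨c4, d4, p4, q4⟩ := h4
  rw [← hF] at c4
  rw [← hG] at d4 q4
  rw [← hT] at p4
  -- step 5
  have e5 : 1 + D4 = (1 + Q) * F / G := by rw [d4, ← i7]; field_simp
  have w5 : B * C4 + A * (1 + B) * (1 + D4) = F * S / G := by
    rw [e5, c4, hS]; field_simp
  have u5 : C4 + A * (1 + D4) = F * H / G := by rw [e5, c4, hH]; field_simp
  obtain ⟨a5, b5, c5, d5⟩ := h5
  rw [w5] at b5 d5
  rw [u5] at c5
  rw [c4] at a5
  have b5' : B5 = Q * P * B * D / S := by rw [b5, d4, c4]; field_simp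
  have c5' : C5 = A * Q * D * P / H := by rw [c5, d4, c4]; field_simp
  have d5' : D5 = S / G := by rw [d5, c4]; field_simp
  -- step 6
  have e6 : 1 + D5 = (1 + B) * H / G := by rw [d5', ← i8]; field_simp
  have f6 : 1 + Q4 = (1 + D) * T / P := by rw [q4, ← i10]; field_simp
  have w6 : D5 * P4 + C5 * (1 + D5) * (1 + Q4) = Q * Z / T := by
    have : Q * Z / T = Q * (Z * G) / (G * T) := by field_simp
    rw [this, ← i11, e6, f6, c5', d5', p4]; field_simp
  have u6 : P4 + C5 * (1 + Q4) = Q * V * G / (T * H) := by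
    have : Q * V * G / (T * H) = Q * (V * G) / (T * H) := by field_simp
    rw [this, ← i12, f6, c5', p4]; field_simp
  obtain ⟨c6, d6, p6, q6⟩ := h6
  rw [w6] at d6 q6
  rw [u6] at p6
  have c6' : C6 = X * Q * P / T := by
    have : X * Q * P / T = Q * P * (X * G) / (G * T) := by field_simp
    rw [this, ← i9, c6, e6, c5', d5', p4]; field_simp
  have d6' : D6 = C * S / Z := by rw [d6, q4, d5', p4]; field_simp
  have p6' : P6 = A * C * D * P * Q / V := by rw [p6, q4, c5', p4]; field_simp
  have q6' : Q6 = Z / (C * P) := by rw [q6, p4]; field_simp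
  exact ⟨a3'.trans a5.symm, b3'.trans b5'.symm, c3'.trans c6'.symm, d3'.trans d6'.symm,
    p2'.trans p6'.symm, q2'.trans q6'.symm⟩

end Rational

/-! ### The tropical semifield -/

/-- The tropical semifield on `ℤ ∪ {∞}`. -/
noncomputable abbrev tropSemifield : Semifield (Tropical (WithTop ℤ)) :=
  { (inferInstance : CommSemiring (Tropical (WithTop ℤ))),
    (inferInstance : Nontrivial (Tropical (WithTop ℤ))) with
    inv := fun x => Tropical.trop (-Tropical.untrop x)
    div := fun x y => x * Tropical.trop (-Tropical.untrop y)
    div_eq_mul_inv := fun _ _ => rfl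
    inv_zero := rfl
    mul_inv_cancel := fun x hx => by
      apply Tropical.untrop_injective
      have hx' : Tropical.untrop x ≠ ⊤ := fun h => hx (Tropical.untrop_injective h)
      obtain ⟨n, hn⟩ := WithTop.ne_top_iff_exists.mp hx'
      change Tropical.untrop x + -Tropical.untrop x = 0
      rw [← hn]
      exact_mod_cast add_neg_cancel n
    nnqsmul := _
    nnqsmul_def := fun _ _ => rfl }

lemma exists_tropicalization : ∃ (K : Type) (_ : Semifield K) (t : ℤ → K),
    (∀ a b : K, a ≠ 0 → a + b ≠ 0) ∧ Function.Injective t ∧ (∀ x, t x ≠ 0) ∧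
    (∀ x y, t (x + y) = t x * t y) ∧ (∀ x y, t (max x y) = t x + t y) ∧ t 0 = 1 := by
  refine ⟨Tropical (WithTop ℤ), tropSemifield, fun x => Tropical.trop ((-x : ℤ) : WithTop ℤ),
    ?_, ?_, ?_, ?_, ?_, ?_⟩
  · intro a b ha h
    apply ha
    apply Tropical.untrop_injective
    have h' : min (Tropical.untrop a) (Tropical.untrop b) = ⊤ := congrArg Tropical.untrop h
    exact (min_eq_top.mp h').1
  · intro x y h
    have h' := Tropical.trop_injective h
    have h2 : -x = -y := by exact_mod_cast h'
    omega
  · intro x h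
    have h' : ((-x : ℤ) : WithTop ℤ) = ⊤ := congrArg Tropical.untrop h
    exact WithTop.coe_ne_top h'
  · intro x y
    apply Tropical.untrop_injective
    change ((-(x + y) : ℤ) : WithTop ℤ) = ((-x : ℤ) : WithTop ℤ) + ((-y : ℤ) : WithTop ℤ)
    rw [neg_add]
    rfl
  · intro x y
    apply Tropical.untrop_injective
    change ((-(max x y) : ℤ) : WithTop ℤ) = min ((-x : ℤ) : WithTop ℤ) ((-y : ℤ) : WithTop ℤ)
    rw [← WithTop.coe_min]
    congr 1
    omega
  · rfl

lemma sigmaMap_rel {K : Type} [Semifield K] (t : ℤ → K)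
    (ht : ∀ x, t x ≠ 0)
    (hadd : ∀ x y, t (x + y) = t x * t y) (hmax : ∀ x y, t (max x y) = t x + t y) (h0 : t 0 = 1)
    (a b c d : ℤ) : ∃ x y z w : ℤ,
      sigmaMap (a, b, c, d) = (x, y, z, w) ∧
        GRel (t a) (t b) (t c) (t d) (t x) (t y) (t z) (t w) := by
  have hone : ∀ x, t (max 0 x) = 1 + t x := fun x => by rw [hmax, h0]
  obtain ⟨M, hM⟩ : ∃ M, M = max (b + c) (a + max 0 b + max 0 d) := ⟨_, rfl⟩
  obtain ⟨N, hN⟩ : ∃ N, N = max c (a + max 0 d) := ⟨_, rfl⟩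
  have tM : t M = t b * t c + t a * (1 + t b) * (1 + t d) := by
    simp only [hM, hmax, hadd, h0]
  have tN : t N = t c + t a * (1 + t d) := by
    simp only [hN, hmax, hadd, h0]
  refine ⟨max (a + max 0 b) (b + c), d + b + c - M, a + c + d - N, M - c, ?_, ?_, ?_, ?_, ?_⟩
  · simp only [sigmaMap, pPart, nPart, Prod.mk.injEq]
    refine ⟨?_, ?_, ?_, ?_⟩ <;> omega
  · simp only [hmax, hadd, h0]
  · rw [← tM, eq_div_iff (ht _), ← hadd, ← hadd, ← hadd]; congr 1; omega
  · rw [← tN, eq_div_iff (ht _), ← hadd, ← hadd, ← hadd]; congr 1; omega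
  · rw [← tM, eq_div_iff (ht _), ← hadd]; congr 1; omega

/-- The braid relation holds for the action on `ℤ⁶`. -/
theorem braid_relation_on_Z6 (v : ℤ × ℤ × ℤ × ℤ × ℤ × ℤ) :
    sigma1 (sigma2 (sigma1 v)) = sigma2 (sigma1 (sigma2 v)) := by
  obtain ⟨K, _, t, hK, hinj, ht, hadd, hmax, h0⟩ := exists_tropicalization
  have key := sigmaMap_rel t ht hadd hmax h0
  obtain ⟨a, b, c, d, p, q⟩ := v
  obtain ⟨a1, b1, c1, d1, h1, r1⟩ := key a b c d
  obtain ⟨c2, d2, p2, q2, h2, r2⟩ := key c1 d1 p q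
  obtain ⟨a3, b3, c3, d3, h3, r3⟩ := key a1 b1 c2 d2
  obtain ⟨c4, d4, p4, q4, h4, r4⟩ := key c d p q
  obtain ⟨a5, b5, c5, d5, h5, r5⟩ := key a b c4 d4
  obtain ⟨c6, d6, p6, q6, h6, r6⟩ := key c5 d5 p4 q4
  obtain ⟨k1, k2, k3, k4, k5, k6⟩ := rational_braid hK _ _ _ _ _ _
    (ht a) (ht b) (ht c) (ht d) (ht p) (ht q) r1 r2 r3 r4 r5 r6
  simp only [sigma1, sigma2, h1, h2, h3, h4, h5, h6, Prod.mk.injEq]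
  exact ⟨hinj k1, hinj k2, hinj k3, hinj k4, hinj k5, hinj k6⟩
end

section
/- The action of VB_n on ℤ^{2n} is well defined: for every n ≥ 2 there exists a group homomorphism from the virtual braid group VB_n (presented on generators σ₁,…,σ_{n-1}, ρ₁,…,ρ_{n-1} with relations σᵢσ_{i+1}σᵢ = σ_{i+1}σᵢσ_{i+1}, σᵢσⱼ = σⱼσᵢ for |i-j| > 1, ρᵢ² = 1, ρᵢρ_{i+1}ρᵢ = ρ_{i+1}ρᵢρ_{i+1}, ρᵢρⱼ = ρⱼρᵢ for |i-j| > 1, σᵢρⱼ = ρⱼσᵢ for |i-j| > 1, and ρᵢρ_{i+1}σᵢ = σ_{i+1}ρᵢρ_{i+1}) to the group of bijections of ℤ^{2n}, sending each σᵢ to the bijection σᵢ and each ρᵢ to the bijection ρᵢ. -/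
/-- The map `σ⁻¹ : ℤ⁴ → ℤ⁴`. -/
def sigmaInvMap : ℤ × ℤ × ℤ × ℤ → ℤ × ℤ × ℤ × ℤ :=
  fun (a, b, c, d) =>
    let f := a + nPart b - c - pPart d
    (a - pPart b - pPart (pPart d + f), d + nPart f,
      c - nPart d - nPart (nPart b - f), b - nPart f)

/-- The action of `σᵢ` (for `i = 0, …, n-2`, zero-based) on `ℤ^{2n}`, viewed as the
space of vectors `(a₁,b₁,…,aₙ,bₙ)`, i.e. functions `Fin n → ℤ × ℤ`: apply `σ` to the
subvector `(aᵢ,bᵢ,a_{i+1},b_{i+1})` and fix all other coordinates. -/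
def sigmaAct (n : ℕ) (i : Fin (n - 1)) (v : Fin n → ℤ × ℤ) : Fin n → ℤ × ℤ :=
  fun k =>
    if k = (⟨i.1, by have := i.2; omega⟩ : Fin n) then
      match sigmaMap ((v ⟨i.1, by have := i.2; omega⟩).1,
          (v ⟨i.1, by have := i.2; omega⟩).2,
          (v ⟨i.1 + 1, by have := i.2; omega⟩).1,
          (v ⟨i.1 + 1, by have := i.2; omega⟩).2) with
      | (x, y, _, _) => (x, y)
    else if k = (⟨i.1 + 1, by have := i.2; omega⟩ : Fin n) then
      match sigmaMap ((v ⟨i.1, by have := i.2; omega⟩).1,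
          (v ⟨i.1, by have := i.2; omega⟩).2,
          (v ⟨i.1 + 1, by have := i.2; omega⟩).1,
          (v ⟨i.1 + 1, by have := i.2; omega⟩).2) with
      | (_, _, z, w) => (z, w)
    else v k

/-- The action of `ρᵢ` (for `i = 0, …, n-2`, zero-based) on `ℤ^{2n}`: apply `ρ` to
the subvector `(aᵢ,bᵢ,a_{i+1},b_{i+1})`, i.e. exchange the `i`-th and `(i+1)`-st
pairs of coordinates, fixing all other coordinates. -/
def rhoAct (n : ℕ) (i : Fin (n - 1)) (v : Fin n → ℤ × ℤ) : Fin n → ℤ × ℤ :=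
  fun k =>
    if k = (⟨i.1, by have := i.2; omega⟩ : Fin n) then
      v ⟨i.1 + 1, by have := i.2; omega⟩
    else if k = (⟨i.1 + 1, by have := i.2; omega⟩ : Fin n) then
      v ⟨i.1, by have := i.2; omega⟩
    else v k

/-- The generator `σᵢ` as an element of the free group on generators
`σ₀,…,σ_{n-2}, ρ₀,…,ρ_{n-2}` (zero-based). -/
def S {n : ℕ} (i : Fin (n - 1)) : FreeGroup (Fin (n - 1) ⊕ Fin (n - 1)) :=
  FreeGroup.of (Sum.inl i)

/-- The generator `ρᵢ` as an element of the free group on generators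
`σ₀,…,σ_{n-2}, ρ₀,…,ρ_{n-2}` (zero-based). -/
def R {n : ℕ} (i : Fin (n - 1)) : FreeGroup (Fin (n - 1) ⊕ Fin (n - 1)) :=
  FreeGroup.of (Sum.inr i)

/-- The defining relators of the virtual braid group `VB_n` on generators
`σ₀,…,σ_{n-2}, ρ₀,…,ρ_{n-2}` (zero-based indexing). -/
def VBrels (n : ℕ) : Set (FreeGroup (Fin (n - 1) ⊕ Fin (n - 1))) :=
  {r | (∃ i j : Fin (n - 1), (j : ℕ) = (i : ℕ) + 1 ∧
          r = S i * S j * S i * (S j * S i * S j)⁻¹) ∨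
       (∃ i j : Fin (n - 1), ((i : ℕ) + 1 < (j : ℕ) ∨ (j : ℕ) + 1 < (i : ℕ)) ∧
          r = S i * S j * (S j * S i)⁻¹) ∨
       (∃ i : Fin (n - 1), r = R i * R i) ∨
       (∃ i j : Fin (n - 1), (j : ℕ) = (i : ℕ) + 1 ∧
          r = R i * R j * R i * (R j * R i * R j)⁻¹) ∨
       (∃ i j : Fin (n - 1), ((i : ℕ) + 1 < (j : ℕ) ∨ (j : ℕ) + 1 < (i : ℕ)) ∧
          r = R i * R j * (R j * R i)⁻¹) ∨
       (∃ i j : Fin (n - 1), ((i : ℕ) + 1 < (j : ℕ) ∨ (j : ℕ) + 1 < (i : ℕ)) ∧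
          r = S i * R j * (R j * S i)⁻¹) ∨
       (∃ i j : Fin (n - 1), (j : ℕ) = (i : ℕ) + 1 ∧
          r = R i * R j * S i * (S j * R i * R j)⁻¹)}

/-! ### The rational lift of `σ` over a semifield -/

section Lift

variable {K : Type*} [Semifield K]

/-- First coordinate of the lift. -/
def lift1 (a b c : K) : K := a + a * b + b * c
/-- The polynomial `N`. -/
def liftN (a b c d : K) : K := b * c + a * (1 + b) * (1 + d)
/-- Second coordinate of the lift. -/
def lift2 (a b c d : K) : K := b * c * d / liftN a b c d
/-- Third coordinate of the lift. -/
def lift3 (a c d : K) : K := a * c * d / (c + a + a * d)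
/-- Fourth coordinate of the lift. -/
def lift4 (a b c d : K) : K := liftN a b c d / c

set_option maxHeartbeats 4000000 in
theorem lift_braid (hadd : ∀ x y : K, x ≠ 0 → x + y ≠ 0) (a b c d e f : K)
    (ha : a ≠ 0) (hb : b ≠ 0) (hc : c ≠ 0) (hd : d ≠ 0) (he : e ≠ 0) (hf : f ≠ 0)
    (x1 y1 x2 y2 x3 y3 x4 y4 p1 q1 p2 q2 p3 q3 p4 q4 : K)
    (hx1 : x1 = lift1 a b c) (hy1 : y1 = lift2 a b c d)
    (hx2 : x2 = lift3 a c d) (hy2 : y2 = lift4 a b c d)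
    (hx3 : x3 = lift1 x2 y2 e) (hy3 : y3 = lift2 x2 y2 e f)
    (hx4 : x4 = lift3 x2 e f) (hy4 : y4 = lift4 x2 y2 e f)
    (hp1 : p1 = lift1 c d e) (hq1 : q1 = lift2 c d e f)
    (hp2 : p2 = lift3 c e f) (hq2 : q2 = lift4 c d e f)
    (hp3 : p3 = lift1 a b p1) (hq3 : q3 = lift2 a b p1 q1)
    (hp4 : p4 = lift3 a p1 q1) (hq4 : q4 = lift4 a b p1 q1) :
    lift1 x1 y1 x3 = p3 ∧ lift2 x1 y1 x3 y3 = q3 ∧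
    lift3 x1 x3 y3 = lift1 p4 q4 p2 ∧ lift4 x1 y1 x3 y3 = lift2 p4 q4 p2 q2 ∧
    x4 = lift3 p4 p2 q2 ∧ y4 = lift4 p4 q4 p2 q2 := by
  simp only [lift1, lift2, lift3, lift4, liftN] at *
  have hN : b * c + a * (1 + b) * (1 + d) ≠ 0 := hadd _ _ (mul_ne_zero hb hc)
  have hQ : c + a + a * d ≠ 0 := hadd _ _ (hadd _ _ hc)
  have hM : d * e + c * (1 + d) * (1 + f) ≠ 0 := hadd _ _ (mul_ne_zero hd he)
  have hp : c + c * d + d * e ≠ 0 := hadd _ _ (hadd _ _ hc)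
  have hW : b * c * e + a * e * (1 + b) * (1 + d) + a * c * d * (1 + b) * (1 + f) ≠ 0 :=
    hadd _ _ (hadd _ _ (mul_ne_zero (mul_ne_zero hb hc) he))
  have hV : (c + a + a * d) * e + a * c * d * (1 + f) ≠ 0 := hadd _ _ (mul_ne_zero hQ he)
  have hU : b * (d * e + c * (1 + d) * (1 + f)) + a * (1 + b) * (1 + f) ≠ 0 :=
    hadd _ _ (mul_ne_zero hb hM)
  have hT : d * e + c * (1 + d) * (1 + f) + a * (1 + f) ≠ 0 := hadd _ _ hM
  have cx3 : x3 = (a * c * d * (1 + b) + (b * c + a * (1 + b) * (1 + d)) * e) / c := by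
    rw [hx3, hx2, hy2]; field_simp (disch := repeat' first
      | assumption | exact one_ne_zero | apply mul_ne_zero | apply pow_ne_zero
      | apply div_ne_zero | apply hadd) <;> ring
  have cNW : y2 * e + x2 * (1 + y2) * (1 + f) =
      (b * c * e + a * e * (1 + b) * (1 + d) + a * c * d * (1 + b) * (1 + f)) / c := by
    rw [hx2, hy2]; field_simp (disch := repeat' first
      | assumption | exact one_ne_zero | apply mul_ne_zero | apply pow_ne_zero
      | apply div_ne_zero | apply hadd) <;> ring
  have cy4 : y4 = (b * c * e + a * e * (1 + b) * (1 + d) + a * c * d * (1 + b) * (1 + f))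
      / (c * e) := by
    rw [hy4, cNW]; field_simp (disch := repeat' first
      | assumption | exact one_ne_zero | apply mul_ne_zero | apply pow_ne_zero
      | apply div_ne_zero | apply hadd) <;> ring
  have cy3 : y3 = (b * c + a * (1 + b) * (1 + d)) * e * f /
      (b * c * e + a * e * (1 + b) * (1 + d) + a * c * d * (1 + b) * (1 + f)) := by
    rw [hy3, cNW, hy2]; field_simp (disch := repeat' first
      | assumption | exact one_ne_zero | apply mul_ne_zero | apply pow_ne_zero
      | apply div_ne_zero | apply hadd) <;> ring
  have cx4 : x4 = a * c * d * e * f / ((c + a + a * d) * e + a * c * d * (1 + f)) := by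
    have : e + x2 + x2 * f = ((c + a + a * d) * e + a * c * d * (1 + f)) / (c + a + a * d) := by
      rw [hx2]; field_simp (disch := repeat' first
      | assumption | exact one_ne_zero | apply mul_ne_zero | apply pow_ne_zero
      | apply div_ne_zero | apply hadd) <;> ring
    rw [hx4, this, hx2]; field_simp (disch := repeat' first
      | assumption | exact one_ne_zero | apply mul_ne_zero | apply pow_ne_zero
      | apply div_ne_zero | apply hadd) <;> ring
  have cNU : b * p1 + a * (1 + b) * (1 + q1) =
      p1 * (b * (d * e + c * (1 + d) * (1 + f)) + a * (1 + b) * (1 + f)) /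
        (d * e + c * (1 + d) * (1 + f)) := by
    rw [hp1, hq1]; field_simp (disch := repeat' first
      | assumption | exact one_ne_zero | apply mul_ne_zero | apply pow_ne_zero
      | apply div_ne_zero | apply hadd) <;> ring
  rw [← hp1] at hp
  have cq4 : q4 = (b * (d * e + c * (1 + d) * (1 + f)) + a * (1 + b) * (1 + f)) /
        (d * e + c * (1 + d) * (1 + f)) := by
    rw [hq4, cNU]; field_simp (disch := repeat' first
      | assumption | exact one_ne_zero | apply mul_ne_zero | apply pow_ne_zero
      | apply div_ne_zero | apply hadd) <;> ring
  have cq3 : q3 = b * d * e * f /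
      (b * (d * e + c * (1 + d) * (1 + f)) + a * (1 + b) * (1 + f)) := by
    rw [hq3, cNU, hq1]; field_simp (disch := repeat' first
      | assumption | exact one_ne_zero | apply mul_ne_zero | apply pow_ne_zero
      | apply div_ne_zero | apply hadd) <;> ring
  have cp4 : p4 = a * d * e * f / (d * e + c * (1 + d) * (1 + f) + a * (1 + f)) := by
    have : p1 + a + a * q1 = p1 * (d * e + c * (1 + d) * (1 + f) + a * (1 + f)) /
        (d * e + c * (1 + d) * (1 + f)) := by
      rw [hp1, hq1]; field_simp (disch := repeat' first
      | assumption | exact one_ne_zero | apply mul_ne_zero | apply pow_ne_zero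
      | apply div_ne_zero | apply hadd) <;> ring
    rw [hp4, this, hq1]; field_simp (disch := repeat' first
      | assumption | exact one_ne_zero | apply mul_ne_zero | apply pow_ne_zero
      | apply div_ne_zero | apply hadd) <;> ring
  clear hx3 hy3 hx4 hy4 hq3 hp4 hq4 cNU cNW
  have hZ : (e + c + c * f) ≠ 0 := hadd _ _ (hadd _ _ he)
  have hX : (a + a * b + b * c) ≠ 0 := hadd _ _ (hadd _ _ ha)
  have hG : (a * c * d * (1 + b) + (b * c + a * (1 + b) * (1 + d)) * e) ≠ 0 := by
    rw [add_comm]; exact hadd _ _ (mul_ne_zero hN he)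
  have hH : ((b * c * e + a * e * (1 + b) * (1 + d) + a * c * d * (1 + b) * (1 + f)) + c * (a + a * b + b * c) * (1 + f)) ≠ 0 := hadd _ _ hW
  have d5 : p2 + p4 + p4 * q2 = f * (d * e + c * (1 + d) * (1 + f)) * ((c + a + a * d) * e + a * c * d * (1 + f)) / (((d * e + c * (1 + d) * (1 + f)) + a * (1 + f)) * (e + c + c * f)) := by
    rw [hp2, cp4, hq2]
    generalize ht : ((d * e + c * (1 + d) * (1 + f)) + a * (1 + f)) = t at *
    field_simp
    subst ht
    ring
  have d6 : q4 * p2 + p4 * (1 + q4) * (1 + q2) = (b * c * e + a * e * (1 + b) * (1 + d) + a * c * d * (1 + b) * (1 + f)) * f / (e + c + c * f) := by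
    have e1 : p4 * (1 + q4) = a * d * e * f * (1 + b) / (d * e + c * (1 + d) * (1 + f)) := by
      rw [cp4, cq4]; field_simp (disch := repeat' first
      | assumption | exact one_ne_zero | apply mul_ne_zero | apply pow_ne_zero
      | apply div_ne_zero | apply hadd) <;> ring
    have e2 : 1 + q2 = (1 + d) * (e + c + c * f) / e := by
      rw [hq2]; field_simp (disch := repeat' first
      | assumption | exact one_ne_zero | apply mul_ne_zero | apply pow_ne_zero
      | apply div_ne_zero | apply hadd) <;> ring
    rw [e1, e2, cq4, hp2]; field_simp (disch := repeat' first
      | assumption | exact one_ne_zero | apply mul_ne_zero | apply pow_ne_zero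
      | apply div_ne_zero | apply hadd) <;> ring
  have d1 : x1 * (1 + y1) = (1 + d) * (a + a * b + b * c) ^ 2 / (b * c + a * (1 + b) * (1 + d)) := by
    rw [hx1, hy1]; field_simp (disch := repeat' first
      | assumption | exact one_ne_zero | apply mul_ne_zero | apply pow_ne_zero
      | apply div_ne_zero | apply hadd) <;> ring
  have d2 : 1 + y3 = (1 + f) * (a * c * d * (1 + b) + (b * c + a * (1 + b) * (1 + d)) * e) / (b * c * e + a * e * (1 + b) * (1 + d) + a * c * d * (1 + b) * (1 + f)) := by
    rw [cy3]
    generalize hw : (b * c * e + a * e * (1 + b) * (1 + d) + a * c * d * (1 + b) * (1 + f)) = w at *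
    field_simp
    subst hw
    ring
  have d3 : y1 * x3 + x1 * (1 + y1) * (1 + y3) = (a * c * d * (1 + b) + (b * c + a * (1 + b) * (1 + d)) * e) * (b * (d * e + c * (1 + d) * (1 + f)) + a * (1 + b) * (1 + f)) / (b * c * e + a * e * (1 + b) * (1 + d) + a * c * d * (1 + b) * (1 + f)) := by
    have e1 : b * d * (b * c * e + a * e * (1 + b) * (1 + d) + a * c * d * (1 + b) * (1 + f)) + (1 + d) * (1 + f) * (a + a * b + b * c) ^ 2 = (b * (d * e + c * (1 + d) * (1 + f)) + a * (1 + b) * (1 + f)) * (b * c + a * (1 + b) * (1 + d)) := by ring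
    have e2 : y1 * x3 + x1 * (1 + y1) * (1 + y3) =
        (a * c * d * (1 + b) + (b * c + a * (1 + b) * (1 + d)) * e) * (b * d * (b * c * e + a * e * (1 + b) * (1 + d) + a * c * d * (1 + b) * (1 + f)) + (1 + d) * (1 + f) * (a + a * b + b * c) ^ 2) / ((b * c + a * (1 + b) * (1 + d)) * (b * c * e + a * e * (1 + b) * (1 + d) + a * c * d * (1 + b) * (1 + f))) := by
      rw [d1, d2, hy1, cx3]
      generalize (a * c * d * (1 + b) + (b * c + a * (1 + b) * (1 + d)) * e) = g at *
      generalize (b * c * e + a * e * (1 + b) * (1 + d) + a * c * d * (1 + b) * (1 + f)) = w at *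
      generalize (a + a * b + b * c) = x at *
      generalize (b * c + a * (1 + b) * (1 + d)) = m at *
      field_simp (disch := repeat' first
      | assumption | exact one_ne_zero | apply mul_ne_zero | apply pow_ne_zero
      | apply div_ne_zero | apply hadd) <;> ring
    rw [e2, e1]
    generalize (b * c + a * (1 + b) * (1 + d)) = m at *
    field_simp (disch := repeat' first
      | assumption | exact one_ne_zero | apply mul_ne_zero | apply pow_ne_zero
      | apply div_ne_zero | apply hadd) <;> ring
  have d4 : x3 + x1 + x1 * y3 = (a * c * d * (1 + b) + (b * c + a * (1 + b) * (1 + d)) * e) * ((b * c * e + a * e * (1 + b) * (1 + d) + a * c * d * (1 + b) * (1 + f)) + c * (a + a * b + b * c) * (1 + f)) / (c * (b * c * e + a * e * (1 + b) * (1 + d) + a * c * d * (1 + b) * (1 + f))) := by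
    have e1 : x3 + x1 + x1 * y3 = x3 + x1 * (1 + y3) := by ring
    rw [e1, d2, cx3, hx1]
    generalize (a * c * d * (1 + b) + (b * c + a * (1 + b) * (1 + d)) * e) = g at *
    generalize (b * c * e + a * e * (1 + b) * (1 + d) + a * c * d * (1 + b) * (1 + f)) = w at *
    field_simp (disch := repeat' first
      | assumption | exact one_ne_zero | apply mul_ne_zero | apply pow_ne_zero
      | apply div_ne_zero | apply hadd) <;> ring
  have d7 : p4 + p4 * q4 + q4 * p2 = e * f * (a * d * (1 + b) * (e + c + c * f) + (b * (d * e + c * (1 + d) * (1 + f)) + a * (1 + b) * (1 + f)) * c) / ((d * e + c * (1 + d) * (1 + f)) * (e + c + c * f)) := by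
    have e1 : p4 + p4 * q4 = a * d * e * f * (1 + b) / (d * e + c * (1 + d) * (1 + f)) := by
      rw [cp4, cq4]; field_simp (disch := repeat' first
      | assumption | exact one_ne_zero | apply mul_ne_zero | apply pow_ne_zero
      | apply div_ne_zero | apply hadd) <;> ring
    rw [e1, cq4, hp2]
    generalize (b * (d * e + c * (1 + d) * (1 + f)) + a * (1 + b) * (1 + f)) = u at *
    generalize (d * e + c * (1 + d) * (1 + f)) = m at *
    field_simp (disch := repeat' first
      | assumption | exact one_ne_zero | apply mul_ne_zero | apply pow_ne_zero
      | apply div_ne_zero | apply hadd) <;> ring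
  have d8 : (a + a * b + b * c) * (b * c + a * (1 + b) * (1 + d)) * ((d * e + c * (1 + d) * (1 + f)) * (e + c + c * f)) = (a * d * (1 + b) * (e + c + c * f) + (b * (d * e + c * (1 + d) * (1 + f)) + a * (1 + b) * (1 + f)) * c) * ((b * c * e + a * e * (1 + b) * (1 + d) + a * c * d * (1 + b) * (1 + f)) + c * (a + a * b + b * c) * (1 + f)) := by ring
  refine ⟨?_, ?_, ?_, ?_, ?_, ?_⟩
  · rw [hp3, hp1, hx1, hy1, cx3]; field_simp (disch := repeat' first
      | assumption | exact one_ne_zero | apply mul_ne_zero | apply pow_ne_zero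
      | apply div_ne_zero | apply hadd) <;> ring
  · rw [d3, cq3, hy1, cy3, cx3]
    generalize (b * (d * e + c * (1 + d) * (1 + f)) + a * (1 + b) * (1 + f)) = u at *
    generalize (a * c * d * (1 + b) + (b * c + a * (1 + b) * (1 + d)) * e) = g at *
    generalize (b * c * e + a * e * (1 + b) * (1 + d) + a * c * d * (1 + b) * (1 + f)) = w at *
    generalize (b * c + a * (1 + b) * (1 + d)) = m at *
    field_simp
  · have e1 : x1 * x3 * y3 / (x3 + x1 + x1 * y3) = e * f * ((a + a * b + b * c) * (b * c + a * (1 + b) * (1 + d))) / ((b * c * e + a * e * (1 + b) * (1 + d) + a * c * d * (1 + b) * (1 + f)) + c * (a + a * b + b * c) * (1 + f)) := by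
      rw [d4, cy3, cx3, hx1]
      generalize (a * c * d * (1 + b) + (b * c + a * (1 + b) * (1 + d)) * e) = g at *
      generalize ((b * c * e + a * e * (1 + b) * (1 + d) + a * c * d * (1 + b) * (1 + f)) + c * (a + a * b + b * c) * (1 + f)) = h at *
      generalize (b * c * e + a * e * (1 + b) * (1 + d) + a * c * d * (1 + b) * (1 + f)) = w at *
      field_simp
    rw [e1, d7, div_eq_div_iff hH (mul_ne_zero hM hZ), mul_assoc (e * f), d8]
    ring
  · rw [d3, d6, cq4, hp2, hq2, cx3]
    generalize (b * (d * e + c * (1 + d) * (1 + f)) + a * (1 + b) * (1 + f)) = u at *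
    generalize (a * c * d * (1 + b) + (b * c + a * (1 + b) * (1 + d)) * e) = g at *
    generalize (b * c * e + a * e * (1 + b) * (1 + d) + a * c * d * (1 + b) * (1 + f)) = w at *
    generalize (d * e + c * (1 + d) * (1 + f)) = m at *
    generalize (e + c + c * f) = z at *
    field_simp
  · rw [d5, cx4, cp4, hp2, hq2]
    generalize ((c + a + a * d) * e + a * c * d * (1 + f)) = v at *
    generalize ((d * e + c * (1 + d) * (1 + f)) + a * (1 + f)) = t at *
    generalize (d * e + c * (1 + d) * (1 + f)) = m at *
    generalize (e + c + c * f) = z at *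
    field_simp
  · rw [d6, cy4, hp2]
    generalize (b * c * e + a * e * (1 + b) * (1 + d) + a * c * d * (1 + b) * (1 + f)) = w at *
    generalize (e + c + c * f) = z at *
    field_simp

end Lift

/-! ### The max-plus semifield -/

/-- The carrier of the tropical semifield. -/
def TZ : Type := Tropical (WithTop ℤ)

instance : CommSemiring TZ := inferInstanceAs (CommSemiring (Tropical (WithTop ℤ)))

open Classical in
/-- The inverse in the tropical semifield. -/
noncomputable def tropInv (x : TZ) : TZ :=
  if x = 0 then 0 else Tropical.trop (((-(Tropical.untrop x).untopD 0 : ℤ)) : WithTop ℤ)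

theorem trop_mul_inv (x : TZ) (hx : x ≠ 0) : x * tropInv x = 1 := by
  have hx' : Tropical.untrop x ≠ ⊤ := fun h => hx (Tropical.untrop_injective h)
  obtain ⟨y, hy⟩ := WithTop.ne_top_iff_exists.1 hx'
  apply Tropical.untrop_injective
  have hi : tropInv x = Tropical.trop (((-(Tropical.untrop x).untopD 0 : ℤ)) : WithTop ℤ) :=
    if_neg hx
  rw [hi]
  change Tropical.untrop x + ((-(Tropical.untrop x).untopD 0 : ℤ) : WithTop ℤ) = ((0 : ℤ) : WithTop ℤ)
  rw [← hy, WithTop.untopD_coe, ← WithTop.coe_add, add_neg_cancel]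

theorem trop_zero_ne_one : (0 : TZ) ≠ 1 := by
  intro h
  exact WithTop.top_ne_coe (Tropical.trop_injective h)

noncomputable instance : Semifield TZ :=
  { (inferInstance : CommSemiring TZ) with
    inv := tropInv
    exists_pair_ne := ⟨0, 1, trop_zero_ne_one⟩
    inv_zero := if_pos rfl
    mul_inv_cancel := trop_mul_inv
    nnqsmul := _
    nnqsmul_def := fun _ _ => rfl }

/-- The embedding turning max-plus into plus-times. -/
def tau (x : ℤ) : TZ := Tropical.trop ((-x : ℤ) : WithTop ℤ)

theorem tau_inj {x y : ℤ} (h : tau x = tau y) : x = y := by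
  have := WithTop.coe_injective (Tropical.trop_injective h)
  omega

theorem tau_add (x y : ℤ) : tau (x + y) = tau x * tau y := by
  have h : -(x + y) = -x + -y := by ring
  unfold tau
  rw [h, WithTop.coe_add]
  rfl

theorem tau_zero : tau 0 = 1 := rfl

theorem tau_max (x y : ℤ) : tau (max x y) = tau x + tau y := by
  have h : -(max x y) = min (-x) (-y) := by omega
  unfold tau
  rw [h, WithTop.coe_min]
  rfl

theorem tau_ne (x : ℤ) : tau x ≠ 0 := by
  intro h
  exact WithTop.coe_ne_top (Tropical.trop_injective h)

theorem tau_sub (x y : ℤ) : tau (x - y) = tau x / tau y := by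
  rw [eq_div_iff (tau_ne y), ← tau_add, sub_add_cancel]

theorem TZ_add (x y : TZ) (hx : x ≠ 0) : x + y ≠ 0 := by
  intro h
  apply hx
  have h' : min (Tropical.untrop x) (Tropical.untrop y) = (⊤ : WithTop ℤ) :=
    congrArg Tropical.untrop h
  exact Tropical.untrop_injective (top_le_iff.1 (h'.symm.le.trans (min_le_left _ _)))

/-! ### `σ` in terms of the lift -/

theorem sigmaMap_tau {a b c d x y z w : ℤ} (h : sigmaMap (a, b, c, d) = (x, y, z, w)) :
    tau x = lift1 (tau a) (tau b) (tau c) ∧ tau y = lift2 (tau a) (tau b) (tau c) (tau d) ∧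
    tau z = lift3 (tau a) (tau c) (tau d) ∧ tau w = lift4 (tau a) (tau b) (tau c) (tau d) := by
  simp only [sigmaMap, pPart, nPart, Prod.mk.injEq] at h
  obtain ⟨h1, h2, h3, h4⟩ := h
  have e1 : x = max (max a (a + b)) (b + c) := by lia
  have e4 : w = max (b + c) (a + max 0 b + max 0 d) - c := by lia
  have e2 : y = b + c + d - max (b + c) (a + max 0 b + max 0 d) := by lia
  have e3 : z = a + c + d - max (max c a) (a + d) := by lia
  rw [e1, e2, e3, e4]
  simp only [tau_sub, tau_max, tau_add, tau_zero, lift1, lift2, lift3, lift4, liftN, and_self]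

theorem sigma_inv_left (t : ℤ × ℤ × ℤ × ℤ) : sigmaInvMap (sigmaMap t) = t := by
  obtain ⟨a, b, c, d⟩ := t
  simp only [sigmaInvMap, sigmaMap, pPart, nPart, Prod.mk.injEq]
  refine ⟨?_, ?_, ?_, ?_⟩ <;> lia

theorem sigma_inv_right (t : ℤ × ℤ × ℤ × ℤ) : sigmaMap (sigmaInvMap t) = t := by
  obtain ⟨a, b, c, d⟩ := t
  simp only [sigmaInvMap, sigmaMap, pPart, nPart, Prod.mk.injEq]
  refine ⟨?_, ?_, ?_, ?_⟩ <;> lia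

/-! ### Local maps -/

/-- Regroup a map of `ℤ⁴` as a map of pairs. -/
def pairUp (g : ℤ × ℤ × ℤ × ℤ → ℤ × ℤ × ℤ × ℤ) (p : (ℤ × ℤ) × (ℤ × ℤ)) :
    (ℤ × ℤ) × (ℤ × ℤ) :=
  (((g (p.1.1, p.1.2, p.2.1, p.2.2)).1, (g (p.1.1, p.1.2, p.2.1, p.2.2)).2.1),
    ((g (p.1.1, p.1.2, p.2.1, p.2.2)).2.2.1, (g (p.1.1, p.1.2, p.2.1, p.2.2)).2.2.2))

/-- Act on the first two of three entries. -/
def actL {P : Type*} (F : P × P → P × P) (t : P × P × P) : P × P × P :=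
  ((F (t.1, t.2.1)).1, (F (t.1, t.2.1)).2, t.2.2)

/-- Act on the last two of three entries. -/
def actR {P : Type*} (F : P × P → P × P) (t : P × P × P) : P × P × P :=
  (t.1, F t.2)

theorem sigma_braid (t : (ℤ × ℤ) × (ℤ × ℤ) × (ℤ × ℤ)) :
    actL (pairUp sigmaMap) (actR (pairUp sigmaMap) (actL (pairUp sigmaMap) t)) =
    actR (pairUp sigmaMap) (actL (pairUp sigmaMap) (actR (pairUp sigmaMap) t)) := by
  obtain ⟨⟨a, b⟩, ⟨c, d⟩, ⟨e, f⟩⟩ := t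
  obtain ⟨x1, y1, x2, y2, h1⟩ : ∃ x y z w, sigmaMap (a, b, c, d) = (x, y, z, w) :=
    ⟨_, _, _, _, rfl⟩
  obtain ⟨x3, y3, x4, y4, h2⟩ : ∃ x y z w, sigmaMap (x2, y2, e, f) = (x, y, z, w) :=
    ⟨_, _, _, _, rfl⟩
  obtain ⟨x5, y5, x6, y6, h3⟩ : ∃ x y z w, sigmaMap (x1, y1, x3, y3) = (x, y, z, w) :=
    ⟨_, _, _, _, rfl⟩
  obtain ⟨p1, q1, p2, q2, g1⟩ : ∃ x y z w, sigmaMap (c, d, e, f) = (x, y, z, w) :=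
    ⟨_, _, _, _, rfl⟩
  obtain ⟨p3, q3, p4, q4, g2⟩ : ∃ x y z w, sigmaMap (a, b, p1, q1) = (x, y, z, w) :=
    ⟨_, _, _, _, rfl⟩
  obtain ⟨p5, q5, p6, q6, g3⟩ : ∃ x y z w, sigmaMap (p4, q4, p2, q2) = (x, y, z, w) :=
    ⟨_, _, _, _, rfl⟩
  simp only [actL, actR, pairUp, h1, h2, h3, g1, g2, g3, Prod.mk.injEq]
  obtain ⟨h11, h12, h13, h14⟩ := sigmaMap_tau h1
  obtain ⟨h21, h22, h23, h24⟩ := sigmaMap_tau h2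
  obtain ⟨h31, h32, h33, h34⟩ := sigmaMap_tau h3
  obtain ⟨g11, g12, g13, g14⟩ := sigmaMap_tau g1
  obtain ⟨g21, g22, g23, g24⟩ := sigmaMap_tau g2
  obtain ⟨g31, g32, g33, g34⟩ := sigmaMap_tau g3
  obtain ⟨r1, r2, r3, r4, r5, r6⟩ := lift_braid TZ_add _ _ _ _ _ _ (tau_ne a) (tau_ne b)
    (tau_ne c) (tau_ne d) (tau_ne e) (tau_ne f) _ _ _ _ _ _ _ _ _ _ _ _ _ _ _ _
    h11 h12 h13 h14 h21 h22 h23 h24 g11 g12 g13 g14 g21 g22 g23 g24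
  exact ⟨⟨tau_inj (h31.trans r1), tau_inj (h32.trans r2)⟩,
    ⟨tau_inj (h33.trans (r3.trans g31.symm)), tau_inj (h34.trans (r4.trans g32.symm))⟩,
    ⟨tau_inj (r5.trans g33.symm), tau_inj (r6.trans g34.symm)⟩⟩

/-! ### Acting on vectors -/

section Vec

variable {P : Type*}

/-- Apply `F` to the entries in positions `i`, `i+1`. -/
def pact (n : ℕ) (F : P × P → P × P) (i : ℕ) (hi : i + 1 < n) (v : Fin n → P) : Fin n → P :=
  fun k =>
    if (k : ℕ) = i then (F (v ⟨i, by omega⟩, v ⟨i + 1, hi⟩)).1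
    else if (k : ℕ) = i + 1 then (F (v ⟨i, by omega⟩, v ⟨i + 1, hi⟩)).2
    else v k

theorem pact_inv (n : ℕ) (F G : P × P → P × P) (hFG : ∀ p, F (G p) = p) (i : ℕ) (hi : i + 1 < n)
    (v : Fin n → P) : pact n F i hi (pact n G i hi v) = v := by
  funext k
  by_cases h1 : (k : ℕ) = i
  · subst h1; simp [pact, hFG]
  · by_cases h2 : (k : ℕ) = i + 1
    · have : k = ⟨i + 1, hi⟩ := Fin.ext h2
      subst this; simp [pact, hFG]
    · simp [pact, h1, h2]

theorem pact_far (n : ℕ) (F G : P × P → P × P) (i j : ℕ) (hi : i + 1 < n) (hj : j + 1 < n)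
    (hij : i + 1 < j ∨ j + 1 < i) (v : Fin n → P) :
    pact n F i hi (pact n G j hj v) = pact n G j hj (pact n F i hi v) := by
  have e1 : i ≠ j := by omega
  have e2 : i ≠ j + 1 := by omega
  have e3 : i + 1 ≠ j := by omega
  funext k
  by_cases h1 : (k : ℕ) = i
  · simp [pact, h1, e1, e2, e3]
  · by_cases h2 : (k : ℕ) = i + 1
    · simp [pact, h2, e1, e2, e3]
    · simp [pact, h1, h2, e1.symm, e2.symm, e3.symm]

/-- Overwrite the entries in positions `i`, `i+1`, `i+2`. -/
def set3 (n : ℕ) (i : ℕ) (v : Fin n → P) (t : P × P × P) : Fin n → P :=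
  fun k => if (k : ℕ) = i then t.1 else if (k : ℕ) = i + 1 then t.2.1
    else if (k : ℕ) = i + 2 then t.2.2 else v k

theorem pact_set3_L (n : ℕ) (F : P × P → P × P) (i : ℕ) (hi : i + 1 < n)
    (v : Fin n → P) (t : P × P × P) :
    pact n F i hi (set3 n i v t) = set3 n i v (actL F t) := by
  funext k
  by_cases h1 : (k : ℕ) = i
  · simp [pact, set3, actL, h1]
  · by_cases h2 : (k : ℕ) = i + 1
    · simp [pact, set3, actL, h2]
    · simp [pact, set3, actL, h1, h2]

theorem pact_set3_R (n : ℕ) (F : P × P → P × P) (i : ℕ) (hi : i + 1 + 1 < n)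
    (v : Fin n → P) (t : P × P × P) :
    pact n F (i + 1) hi (set3 n i v t) = set3 n i v (actR F t) := by
  have e0 : i + 1 + 1 ≠ i := by omega
  have e0' : i ≠ i + 1 + 1 := by omega
  funext k
  by_cases h1 : (k : ℕ) = i
  · simp [pact, set3, actR, h1, e0']
  · by_cases h2 : (k : ℕ) = i + 1
    · simp [pact, set3, actR, h2, e0]
    · by_cases h3 : (k : ℕ) = i + 2
      · simp [pact, set3, actR, h3, e0]
      · simp [pact, set3, actR, h1, h2, h3]

theorem set3_self (n : ℕ) (i : ℕ) (hi : i + 1 + 1 < n) (v : Fin n → P) :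
    v = set3 n i v (v ⟨i, by omega⟩, v ⟨i + 1, by omega⟩, v ⟨i + 1 + 1, hi⟩) := by
  funext k
  simp only [set3]
  split_ifs with h1 h2 h3
  · congr 1; exact Fin.ext h1
  · congr 1; exact Fin.ext h2
  · congr 1; exact Fin.ext h3
  · rfl

theorem pact_braid (n : ℕ) (F1 F2 F3 G1 G2 G3 : P × P → P × P)
    (h : ∀ t, actL F1 (actR F2 (actL F3 t)) = actR G1 (actL G2 (actR G3 t)))
    (i j : ℕ) (hij : j = i + 1) (hi : i + 1 < n) (hj : j + 1 < n) (v : Fin n → P) :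
    pact n F1 i hi (pact n F2 j hj (pact n F3 i hi v)) =
    pact n G1 j hj (pact n G2 i hi (pact n G3 j hj v)) := by
  subst hij
  rw [set3_self n i hj v]
  simp only [pact_set3_L, pact_set3_R, h]

end Vec

theorem pairUp_inv (f g : ℤ × ℤ × ℤ × ℤ → ℤ × ℤ × ℤ × ℤ) (h : ∀ t, f (g t) = t)
    (p : (ℤ × ℤ) × (ℤ × ℤ)) : pairUp f (pairUp g p) = p := by
  simp [pairUp, h]

theorem fin_pred_lt {n : ℕ} (i : Fin (n - 1)) : (i : ℕ) + 1 < n := by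
  have := i.2
  omega

/-- The bijection `σᵢ`. -/
def sigmaPerm (n : ℕ) (i : Fin (n - 1)) : Equiv.Perm (Fin n → ℤ × ℤ) where
  toFun := pact n (pairUp sigmaMap) i (fin_pred_lt i)
  invFun := pact n (pairUp sigmaInvMap) i (fin_pred_lt i)
  left_inv := pact_inv n _ _ (pairUp_inv _ _ sigma_inv_left) _ _
  right_inv := pact_inv n _ _ (pairUp_inv _ _ sigma_inv_right) _ _

/-- The bijection `ρᵢ`. -/
def rhoPerm (n : ℕ) (i : Fin (n - 1)) : Equiv.Perm (Fin n → ℤ × ℤ) where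
  toFun := pact n Prod.swap i (fin_pred_lt i)
  invFun := pact n Prod.swap i (fin_pred_lt i)
  left_inv := pact_inv n _ _ Prod.swap_swap _ _
  right_inv := pact_inv n _ _ Prod.swap_swap _ _

theorem sigmaPerm_apply (n : ℕ) (i : Fin (n - 1)) (v : Fin n → ℤ × ℤ) :
    sigmaPerm n i v = sigmaAct n i v := by
  funext k
  simp only [sigmaPerm, Equiv.coe_fn_mk, pact, sigmaAct, pairUp, Fin.ext_iff]

theorem rhoPerm_apply (n : ℕ) (i : Fin (n - 1)) (v : Fin n → ℤ × ℤ) :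
    rhoPerm n i v = rhoAct n i v := by
  funext k
  simp only [rhoPerm, Equiv.coe_fn_mk, pact, rhoAct, Prod.swap, Fin.ext_iff]

/-- The images of the generators. -/
def genPerm (n : ℕ) : Fin (n - 1) ⊕ Fin (n - 1) → Equiv.Perm (Fin n → ℤ × ℤ) :=
  Sum.elim (sigmaPerm n) (rhoPerm n)

theorem genPerm_rels (n : ℕ) : ∀ r ∈ VBrels n, FreeGroup.lift (genPerm n) r = 1 := by
  rintro r (⟨i, j, hij, rfl⟩ | ⟨i, j, hij, rfl⟩ | ⟨i, rfl⟩ | ⟨i, j, hij, rfl⟩ |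
    ⟨i, j, hij, rfl⟩ | ⟨i, j, hij, rfl⟩ | ⟨i, j, hij, rfl⟩) <;>
  simp only [map_mul, map_inv, S, R, FreeGroup.lift_apply_of, genPerm, Sum.elim_inl,
    Sum.elim_inr]
  · rw [mul_inv_eq_one]
    exact Equiv.ext fun v => pact_braid n _ _ _ _ _ _ sigma_braid i j hij _ _ v
  · rw [mul_inv_eq_one]
    exact Equiv.ext fun v => pact_far n _ _ i j _ _ hij v
  · exact Equiv.ext fun v => pact_inv n _ _ Prod.swap_swap _ _ v
  · rw [mul_inv_eq_one]
    exact Equiv.ext fun v => pact_braid n _ _ _ _ _ _ (fun _ => rfl) i j hij _ _ v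
  · rw [mul_inv_eq_one]
    exact Equiv.ext fun v => pact_far n _ _ i j _ _ hij v
  · rw [mul_inv_eq_one]
    exact Equiv.ext fun v => pact_far n _ _ i j _ _ hij v
  · rw [mul_inv_eq_one]
    exact Equiv.ext fun v => pact_braid n _ _ _ _ _ _ (fun _ => rfl) i j hij _ _ v

/-- The action of `VB_n` on `ℤ^{2n}` is well defined: there is a group homomorphism
from the virtual braid group `VB_n` (presented on generators `σᵢ`, `ρᵢ` with the
braid, symmetric and mixed relations) to the group of bijections of `ℤ^{2n}`,
sending each `σᵢ` to the bijection `σᵢ` and each `ρᵢ` to the bijection `ρᵢ`. -/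
theorem VBn_action_well_defined (n : ℕ) (hn : 2 ≤ n) :
    ∃ φ : PresentedGroup (VBrels n) →* Equiv.Perm (Fin n → ℤ × ℤ),
      (∀ i : Fin (n - 1), ∀ v : Fin n → ℤ × ℤ,
        φ (PresentedGroup.of (Sum.inl i)) v = sigmaAct n i v) ∧
      (∀ i : Fin (n - 1), ∀ v : Fin n → ℤ × ℤ,
        φ (PresentedGroup.of (Sum.inr i)) v = rhoAct n i v) := by
  refine ⟨PresentedGroup.toGroup (genPerm_rels n), fun i v => ?_, fun i v => ?_⟩
  · rw [PresentedGroup.toGroup.of]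
    exact sigmaPerm_apply n i v
  · rw [PresentedGroup.toGroup.of]
    exact rhoPerm_apply n i v
end
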